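/- For the walk started at (1,1), the probability that it hits the boundary for the first time exactly at the point (0,2) equals (243√3)/(40π) − 3 (≈ 0.3493); that is, P_{(1,1)}( τ < ∞ and X_τ = (0,2) ) = (243√3)/(40π) − 3. -/

import Mathlib

/-- The step set of the walk: each increment is `(1,0)`, `(−1,1)` or `(0,−1)`. -/
def stepSet : Set (ℤ × ℤ) := {(1, 0), (-1, 1), (0, -1)}

/-- The boundary of the nonnegative quadrant: points with a zero coordinate. -/
def onBoundary (p : ℤ × ℤ) : Prop := p.1 = 0 ∨ p.2 = 0

/-- The position after `k` steps of the walk started at `z` with increment sequence `w`. -/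
def walkPos (z : ℤ × ℤ) {n : ℕ} (w : Fin n → ℤ × ℤ) (k : ℕ) : ℤ × ℤ :=
  z + ∑ i ∈ Finset.univ.filter (fun i : Fin n => (i : ℕ) < k), w i

/-- The number of `n`-step increment sequences (with steps in `stepSet`) whose walk started
at `z` stays off the boundary strictly before time `n` and whose position at time `n`
satisfies `P`.  Each such trajectory has probability `(1/3)^n` under the i.i.d. uniform
step distribution. -/
noncomputable def firstHitCount (z : ℤ × ℤ) (P : ℤ × ℤ → Prop) (n : ℕ) : ℕ :=
  Nat.card {w : Fin n → ℤ × ℤ //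
    (∀ i, w i ∈ stepSet) ∧ (∀ k < n, ¬ onBoundary (walkPos z w k)) ∧ P (walkPos z w n)}

/-- `hitProb z P = P_z(τ < ∞ and X_τ satisfies P)`: the probability that the walk started
at `z`, with i.i.d. increments uniform on `stepSet`, first hits the boundary `∂` at a point
satisfying `P`.  It is computed by decomposing the event over the value `n` of the hitting
time `τ`. -/
noncomputable def hitProb (z : ℤ × ℤ) (P : ℤ × ℤ → Prop) : ℝ :=
  ∑' n : ℕ, (1/3 : ℝ) ^ n * firstHitCount z P n

open Filter Topology Finset

/-! ### The first-step recursion -/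

theorem walkPos_cons_succ (z s : ℤ × ℤ) {n : ℕ} (w : Fin n → ℤ × ℤ) (k : ℕ) :
    walkPos z (Fin.cons s w : Fin (n + 1) → ℤ × ℤ) (k + 1) = walkPos (z + s) w k := by
  simp [walkPos, Finset.sum_filter, Fin.sum_univ_succ, add_assoc]

theorem walkPos_zero (z : ℤ × ℤ) {n : ℕ} (w : Fin n → ℤ × ℤ) : walkPos z w 0 = z := by
  simp [walkPos]

theorem firstHitCount_zero (z : ℤ × ℤ) (P : ℤ × ℤ → Prop) [Decidable (P z)] :
    firstHitCount z P 0 = if P z then 1 else 0 := by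
  unfold firstHitCount
  split_ifs with h <;> simp [walkPos_zero, h]

theorem firstHitCount_succ_of_onBoundary {z : ℤ × ℤ} (hz : onBoundary z) (P : ℤ × ℤ → Prop)
    (n : ℕ) : firstHitCount z P (n + 1) = 0 := by
  unfold firstHitCount
  have : IsEmpty {w : Fin (n + 1) → ℤ × ℤ // (∀ i, w i ∈ stepSet) ∧
      (∀ k < n + 1, ¬ onBoundary (walkPos z w k)) ∧ P (walkPos z w (n + 1))} :=
    ⟨fun ⟨w, _, h, _⟩ => h 0 n.succ_pos (by rwa [walkPos_zero])⟩
  exact Nat.card_of_isEmpty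

/-- Splitting a trajectory that starts off the boundary into its first step and the rest. -/
def firstStepEquiv {z : ℤ × ℤ} (hz : ¬ onBoundary z) (P : ℤ × ℤ → Prop) (n : ℕ) :
    {w : Fin (n + 1) → ℤ × ℤ // (∀ i, w i ∈ stepSet) ∧
      (∀ k < n + 1, ¬ onBoundary (walkPos z w k)) ∧ P (walkPos z w (n + 1))} ≃
    Σ s : {s : ℤ × ℤ // s ∈ ({(1, 0), (-1, 1), (0, -1)} : Finset (ℤ × ℤ))},
      {w : Fin n → ℤ × ℤ // (∀ i, w i ∈ stepSet) ∧
        (∀ k < n, ¬ onBoundary (walkPos (z + s) w k)) ∧ P (walkPos (z + s) w n)} where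
  toFun w := ⟨⟨w.1 0, by simpa [stepSet] using w.2.1 0⟩, Fin.tail w.1, by
    obtain ⟨w, h1, h2, h3⟩ := w
    have hw : (Fin.cons (w 0) (Fin.tail w) : Fin (n + 1) → ℤ × ℤ) = w := Fin.cons_self_tail w
    refine ⟨fun i => h1 i.succ, fun k hk => ?_, ?_⟩
    · rw [← walkPos_cons_succ, hw]
      exact h2 _ (by omega)
    · rw [← walkPos_cons_succ, hw]
      exact h3⟩
  invFun p := ⟨Fin.cons p.1.1 p.2.1, by
    obtain ⟨⟨s, hs⟩, w, h1, h2, h3⟩ := p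
    refine ⟨fun i => ?_, fun k hk => ?_, ?_⟩
    · induction i using Fin.cases with
      | zero => simpa [stepSet] using hs
      | succ i => simpa using h1 i
    · cases k with
      | zero => rwa [walkPos_zero]
      | succ k =>
        rw [walkPos_cons_succ]
        exact h2 k (by omega)
    · rw [walkPos_cons_succ]
      exact h3⟩
  left_inv w := Subtype.ext (Fin.cons_self_tail w.1)
  right_inv p := by
    obtain ⟨⟨s, hs⟩, w, h⟩ := p
    rfl

theorem firstHitCount_succ {z : ℤ × ℤ} (hz : ¬ onBoundary z) (P : ℤ × ℤ → Prop) (n : ℕ) :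
    firstHitCount z P (n + 1) = firstHitCount (z + (1, 0)) P n +
      firstHitCount (z + (-1, 1)) P n + firstHitCount (z + (0, -1)) P n := by
  have hfin (y : ℤ × ℤ) : Finite {w : Fin n → ℤ × ℤ // (∀ i, w i ∈ stepSet) ∧
      (∀ k < n, ¬ onBoundary (walkPos y w k)) ∧ P (walkPos y w n)} := by
    have hS : stepSet.Finite := by simp [stepSet]
    exact ((Set.Finite.pi' fun _ : Fin n => hS).subset fun w hw => hw.1).to_subtype
  rw [firstHitCount, Nat.card_congr (firstStepEquiv hz P n), Nat.card_sigma]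
  change ∑ s : {s : ℤ × ℤ // s ∈ ({(1, 0), (-1, 1), (0, -1)} : Finset (ℤ × ℤ))},
    firstHitCount (z + s) P n = _
  rw [Finset.sum_coe_sort _ (fun s => firstHitCount (z + s) P n),
    Finset.sum_insert (by decide), Finset.sum_insert (by decide), Finset.sum_singleton, add_assoc]

/-! ### Closed form for the number of trajectories -/

/-- The reciprocal of the factorial, extended by zero to negative integers. -/
noncomputable def invFactorial (k : ℤ) : ℝ := if k < 0 then 0 else ((k.toNat.factorial : ℝ))⁻¹

theorem invFactorial_natCast (k : ℕ) : invFactorial k = ((k.factorial : ℝ))⁻¹ := by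
  simp [invFactorial]

theorem invFactorial_of_neg {k : ℤ} (hk : k < 0) : invFactorial k = 0 := if_pos hk

theorem invFactorial_sub_one (k : ℤ) : invFactorial (k - 1) = k * invFactorial k := by
  rcases lt_trichotomy k 0 with hk | rfl | hk
  · rw [invFactorial_of_neg hk, invFactorial_of_neg (by omega), mul_zero]
  · simp [invFactorial]
  · obtain ⟨m, rfl⟩ : ∃ m : ℕ, k = (m + 1 : ℕ) := ⟨(k - 1).toNat, by omega⟩
    have h : ((m + 1 : ℕ) : ℤ) - 1 = (m : ℕ) := by push_cast; ring
    rw [h, invFactorial_natCast, invFactorial_natCast, Nat.factorial_succ]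
    have := Nat.factorial_ne_zero m
    push_cast
    field_simp

/-- The hook length formula for trajectories from `(x, y)` to `(0, 2)`. -/
theorem firstHitCount_eq (n : ℕ) : ∀ m x y : ℤ, 0 ≤ x → 0 ≤ y → 3 * m + 2 * x + y = n + 3 →
    (firstHitCount (x, y) (· = (0, 2)) (n + 1) : ℝ) = n.factorial * (x * y * (x + y)) *
      (invFactorial m * invFactorial (m + x) * invFactorial (m + x + y)) := by
  induction n with
  | zero =>
    intro m x y hx hy h
    by_cases hb : onBoundary (x, y)
    · rw [firstHitCount_succ_of_onBoundary hb]
      rcases hb with rfl | rfl <;> simp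
    rw [firstHitCount_succ hb]
    simp only [onBoundary, not_or] at hb
    simp only [firstHitCount_zero, Prod.mk_add_mk, Prod.mk.injEq]
    rcases lt_or_ge m 0 with hm | hm
    · rw [if_neg (by omega), if_neg (by omega), if_neg (by omega), invFactorial_of_neg hm]
      simp
    · obtain rfl : x = 1 := by omega
      obtain rfl : y = 1 := by omega
      obtain rfl : m = 0 := by omega
      rw [show (0 : ℤ) + 1 + 1 = (2 : ℕ) by norm_num, invFactorial_natCast]
      norm_num [invFactorial]
  | succ n ih =>
    intro m x y hx hy h
    by_cases hb : onBoundary (x, y)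
    · rw [firstHitCount_succ_of_onBoundary hb]
      rcases hb with rfl | rfl <;> simp
    rw [firstHitCount_succ hb]
    simp only [onBoundary, not_or] at hb
    push_cast at h
    simp only [Prod.mk_add_mk, add_zero]
    push_cast
    rw [ih (m - 1) (x + 1) y (by omega) hy (by omega),
      ih m (x + -1) (y + 1) (by omega) (by omega) (by omega),
      ih m x (y + -1) hx (by omega) (by omega)]
    rw [show m - 1 + (x + 1) = m + x by ring, show m + (x + -1) = m + x - 1 by ring,
      show m + x - 1 + (y + 1) = m + x + y by ring,
      show m + x + (y + -1) = m + x + y - 1 by ring,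
      invFactorial_sub_one, invFactorial_sub_one, invFactorial_sub_one, Nat.factorial_succ]
    have hn : (n : ℝ) = 3 * m + 2 * x + y - 4 := by
      have : (n : ℤ) = 3 * m + 2 * x + y - 4 := by omega
      exact_mod_cast this
    push_cast
    rw [hn]
    ring

theorem firstHitCount_eq_zero (n : ℕ) : ∀ x y : ℤ, ¬ (3 : ℤ) ∣ 2 * x + y - n - 2 →
    firstHitCount (x, y) (· = (0, 2)) n = 0 := by
  induction n with
  | zero =>
    intro x y h
    rw [firstHitCount_zero, if_neg]
    rintro ⟨⟩
    simp at h
  | succ n ih =>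
    intro x y h
    by_cases hb : onBoundary (x, y)
    · exact firstHitCount_succ_of_onBoundary hb _ _
    rw [firstHitCount_succ hb]
    push_cast at h
    simp only [Prod.mk_add_mk]
    rw [ih _ _ (by omega), ih _ _ (by omega), ih _ _ (by omega)]

theorem firstHitCount_one_one (m : ℕ) :
    (firstHitCount (1, 1) (· = (0, 2)) (3 * m + 1) : ℝ) =
      2 * (3 * m).factorial / (m.factorial * (m + 1).factorial * (m + 2).factorial) := by
  rw [firstHitCount_eq (3 * m) m 1 1 (by omega) (by omega) (by push_cast; ring),
    show (m : ℤ) + 1 + 1 = (m + 2 : ℕ) by push_cast; ring,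
    show (m : ℤ) + 1 = (m + 1 : ℕ) by push_cast; ring]
  simp only [invFactorial_natCast]
  push_cast
  field_simp
  norm_num

/-! ### The Gauss summation of `₂F₁(-2/3, -1/3; c; 1)` -/

/-- The `n`-th term of the hypergeometric series `₂F₁(-2/3, -1/3; c; 1)`. -/
noncomputable def gaussTerm (c : ℝ) : ℕ → ℝ
  | 0 => 1
  | n + 1 => gaussTerm c n * ((n - 2 / 3) * (n - 1 / 3) / ((n + 1) * (c + n)))

theorem factor_nonneg (n : ℕ) : 0 ≤ ((n : ℝ) - 2 / 3) * (n - 1 / 3) := by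
  rcases n with _ | n
  · norm_num
  · push_cast
    have : (0 : ℝ) ≤ n := n.cast_nonneg
    nlinarith

theorem gaussTerm_nonneg {c : ℝ} (hc : 2 ≤ c) (n : ℕ) : 0 ≤ gaussTerm c n := by
  induction n with
  | zero => simp [gaussTerm]
  | succ n ih =>
    have := factor_nonneg n
    rw [gaussTerm]
    positivity

theorem gaussTerm_le {c : ℝ} (hc : 2 ≤ c) (n : ℕ) : gaussTerm c n ≤ 1 / ((n : ℝ) + 1) ^ 2 := by
  induction n with
  | zero => simp [gaussTerm]
  | succ n ih =>
    have hn : (0 : ℝ) ≤ n := n.cast_nonneg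
    have h0 := factor_nonneg n
    have hr : ((n : ℝ) - 2 / 3) * (n - 1 / 3) / ((n + 1) * (c + n)) ≤
        (n + 1) ^ 2 / (n + 1 + 1) ^ 2 := by
      rw [div_le_div_iff₀ (by positivity) (by positivity)]
      calc ((n : ℝ) - 2 / 3) * (n - 1 / 3) * (n + 1 + 1) ^ 2
          ≤ (n + 1) ^ 2 * ((n + 1) * (2 + n)) := by
            have : 0 ≤ (n : ℝ) ^ 2 := by positivity
            have : 0 ≤ (n : ℝ) ^ 3 := by positivity
            nlinarith
        _ ≤ (n + 1) ^ 2 * ((n + 1) * (c + n)) := by gcongr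
    rw [gaussTerm]
    push_cast
    calc _ ≤ 1 / ((n : ℝ) + 1) ^ 2 * ((n + 1) ^ 2 / (n + 1 + 1) ^ 2) :=
          mul_le_mul ih hr (by positivity) (by positivity)
      _ = _ := by field_simp

theorem summable_one_div_succ_sq : Summable fun n : ℕ => 1 / ((n : ℝ) + 1) ^ 2 := by
  simpa using (summable_nat_add_iff 1).mpr (Real.summable_one_div_nat_pow.mpr one_lt_two)

theorem summable_gaussTerm {c : ℝ} (hc : 2 ≤ c) : Summable (gaussTerm c) :=
  Summable.of_nonneg_of_le (gaussTerm_nonneg hc) (gaussTerm_le hc) summable_one_div_succ_sq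

theorem gaussTerm_add_one {c : ℝ} (hc : 2 ≤ c) (n : ℕ) :
    gaussTerm (c + 1) n = gaussTerm c n * (c / (c + n)) := by
  induction n with
  | zero =>
    have : c ≠ 0 := by positivity
    simp [gaussTerm, this]
  | succ n ih =>
    rw [gaussTerm, gaussTerm, ih]
    push_cast
    have h1 : c + n ≠ 0 := by positivity
    have h2 : c + 1 + n ≠ 0 := by positivity
    have h3 : c + (n + 1) ≠ 0 := by positivity
    field_simp
    ring

/-- The contiguous relation, summed up to `N`. -/
theorem sum_gaussTerm_contiguous {c : ℝ} (hc : 2 ≤ c) (N : ℕ) :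
    c * (c + 1) * ∑ n ∈ range N, gaussTerm c n -
      (c + 2 / 3) * (c + 1 / 3) * ∑ n ∈ range N, gaussTerm (c + 1) n =
      -(c * (N * gaussTerm c N)) := by
  induction N with
  | zero => simp
  | succ N ih =>
    rw [sum_range_succ, sum_range_succ, mul_add (c * (c + 1)),
      mul_add ((c + 2 / 3) * (c + 1 / 3)), add_sub_add_comm, ih, gaussTerm_add_one hc, gaussTerm]
    have h1 : c + N ≠ 0 := by positivity
    have h2 : (N : ℝ) + 1 ≠ 0 := by positivity
    push_cast
    field_simp
    ring

theorem tendsto_mul_gaussTerm {c : ℝ} (hc : 2 ≤ c) :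
    Tendsto (fun n : ℕ => (n : ℝ) * gaussTerm c n) atTop (𝓝 0) := by
  refine squeeze_zero (fun n => mul_nonneg n.cast_nonneg (gaussTerm_nonneg hc n)) (fun n => ?_)
    (tendsto_one_div_add_atTop_nhds_zero_nat (𝕜 := ℝ))
  calc (n : ℝ) * gaussTerm c n ≤ (n + 1) * (1 / ((n : ℝ) + 1) ^ 2) :=
        mul_le_mul (by linarith) (gaussTerm_le hc n) (gaussTerm_nonneg hc n) (by positivity)
    _ = 1 / ((n : ℝ) + 1) := by field_simp

theorem tsum_gaussTerm_contiguous {c : ℝ} (hc : 2 ≤ c) :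
    c * (c + 1) * ∑' n, gaussTerm c n =
      (c + 2 / 3) * (c + 1 / 3) * ∑' n, gaussTerm (c + 1) n := by
  have h1 := (summable_gaussTerm hc).hasSum.tendsto_sum_nat.const_mul (c * (c + 1))
  have h2 := (summable_gaussTerm (c := c + 1) (by linarith)).hasSum.tendsto_sum_nat.const_mul
    ((c + 2 / 3) * (c + 1 / 3))
  have h3 := ((tendsto_mul_gaussTerm hc).const_mul c).neg
  have h := tendsto_nhds_unique ((h1.sub h2).congr (sum_gaussTerm_contiguous hc)) h3
  linarith

theorem tsum_gaussTerm_two (N : ℕ) :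
    ∑' n, gaussTerm 2 n = (∏ j ∈ range N, (1 - (1 / 3 : ℝ) ^ 2 / ((j : ℝ) + 1) ^ 2)) *
      (27 / 20 * ((N + 4 / 3) * (N + 2 / 3) * (N + 5 / 3) / ((N + 1) ^ 2 * (N + 2)))) *
      ∑' n, gaussTerm (N + 2) n := by
  induction N with
  | zero => norm_num
  | succ N ih =>
    have h := tsum_gaussTerm_contiguous (c := N + 2) (by linarith [(N.cast_nonneg : (0 : ℝ) ≤ N)])
    have h' : ∑' n, gaussTerm (N + 2) n = ((N : ℝ) + 2 + 2 / 3) * (N + 2 + 1 / 3) /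
        ((N + 2) * (N + 2 + 1)) * ∑' n, gaussTerm (N + 2 + 1) n := by
      rw [div_mul_eq_mul_div, eq_div_iff (by positivity), ← h]
      ring
    rw [ih, h', prod_range_succ]
    push_cast
    rw [show (N : ℝ) + 1 + 2 = N + 2 + 1 by ring]
    field_simp
    ring

theorem tendsto_gaussTerm_succ (n : ℕ) :
    Tendsto (fun N : ℕ => gaussTerm ((N : ℝ) + 2) (n + 1)) atTop (𝓝 0) := by
  have hlim := (tendsto_one_div_add_atTop_nhds_zero_nat (𝕜 := ℝ)).const_mul
    (((n : ℝ) - 2 / 3) * (n - 1 / 3))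
  rw [mul_zero] at hlim
  refine squeeze_zero (fun N => gaussTerm_nonneg (by linarith [(N.cast_nonneg : (0 : ℝ) ≤ N)]) _)
    (fun N => ?_) hlim
  have hN : (2 : ℝ) ≤ N + 2 := by linarith [(N.cast_nonneg : (0 : ℝ) ≤ N)]
  have h0 := factor_nonneg n
  have hn : (0 : ℝ) ≤ n := n.cast_nonneg
  have h1 : gaussTerm ((N : ℝ) + 2) n ≤ 1 :=
    (gaussTerm_le hN n).trans (div_le_one_of_le₀ (by nlinarith) (by positivity))
  rw [gaussTerm]
  calc _ ≤ 1 * (((n : ℝ) - 2 / 3) * (n - 1 / 3) / ((n + 1) * (N + 2 + n))) := by gcongr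
    _ ≤ ((n : ℝ) - 2 / 3) * (n - 1 / 3) / (N + 1) := by
      rw [one_mul]
      gcongr
      nlinarith
    _ = _ := by ring

theorem tendsto_tsum_gaussTerm :
    Tendsto (fun N : ℕ => ∑' n, gaussTerm ((N : ℝ) + 2) n) atTop (𝓝 1) := by
  have hlim (n : ℕ) : Tendsto (fun N : ℕ => gaussTerm ((N : ℝ) + 2) n) atTop
      (𝓝 (if n = 0 then 1 else 0)) := by
    cases n with
    | zero => simp [gaussTerm]
    | succ n => simpa using tendsto_gaussTerm_succ n
  have h := tendsto_tsum_of_dominated_convergence summable_one_div_succ_sq hlim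
    (Eventually.of_forall fun N n => by
      have hN : (2 : ℝ) ≤ N + 2 := by linarith [(N.cast_nonneg : (0 : ℝ) ≤ N)]
      rw [Real.norm_of_nonneg (gaussTerm_nonneg hN n)]
      exact gaussTerm_le hN n)
  simpa using h

theorem tendsto_rational_factor :
    Tendsto (fun N : ℕ => 27 / 20 * (((N : ℝ) + 4 / 3) * (N + 2 / 3) * (N + 5 / 3) /
      ((N + 1) ^ 2 * (N + 2)))) atTop (𝓝 (27 / 20)) := by
  have hlin (a b : ℝ) (hb : 0 < b) : Tendsto (fun N : ℕ => ((N : ℝ) + a) / (N + b)) atTop (𝓝 1) := by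
    have h : Tendsto (fun N : ℕ => 1 + (a - b) / ((N : ℝ) + b)) atTop (𝓝 (1 + 0)) :=
      tendsto_const_nhds.add ((tendsto_natCast_atTop_atTop.atTop_add
        tendsto_const_nhds).const_div_atTop _)
    rw [add_zero] at h
    refine h.congr fun N => ?_
    have : (N : ℝ) + b ≠ 0 := by positivity
    field_simp
    ring
  have h := ((((hlin (4 / 3) 1 one_pos).mul (hlin (2 / 3) 1 one_pos)).mul
    (hlin (5 / 3) 2 two_pos))).const_mul (27 / 20)
  simp only [mul_one] at h
  refine h.congr fun N => ?_
  field_simp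

theorem tsum_gaussTerm_two_eq : ∑' n, gaussTerm 2 n = 81 * √3 / (40 * Real.pi) := by
  have hpi := Real.pi_ne_zero
  have hsin : Tendsto (fun N : ℕ => ∏ j ∈ range N, (1 - (1 / 3 : ℝ) ^ 2 / ((j : ℝ) + 1) ^ 2)) atTop
      (𝓝 (3 / Real.pi * (√3 / 2))) := by
    have h := (Real.tendsto_euler_sin_prod (1 / 3)).const_mul (3 / Real.pi)
    rw [mul_one_div, Real.sin_pi_div_three] at h
    refine h.congr fun N => ?_
    field_simp
  have h := (hsin.mul tendsto_rational_factor).mul tendsto_tsum_gaussTerm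
  rw [tendsto_nhds_unique (tendsto_const_nhds.congr tsum_gaussTerm_two) h]
  field_simp
  ring

/-! ### The hitting probability -/

theorem hitTerm_eq_gaussTerm (m : ℕ) :
    (1 / 3 : ℝ) ^ (3 * m + 1) *
      (2 * (3 * m).factorial / (m.factorial * (m + 1).factorial * (m + 2).factorial)) =
      3 * gaussTerm 2 (m + 1) := by
  induction m with
  | zero => norm_num [gaussTerm, Nat.factorial]
  | succ m ih =>
    rw [gaussTerm, ← mul_assoc, ← ih, show 3 * (m + 1) = 3 * m + 1 + 1 + 1 by ring]
    simp only [Nat.factorial_succ, pow_succ]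
    push_cast
    have := Nat.factorial_ne_zero m
    field_simp
    ring

/-- `P_{(1,1)}(τ < ∞ and X_τ = (0,2)) = (243√3)/(40π) − 3`. -/
theorem hitProb_eq : hitProb (1, 1) (· = (0, 2)) = 243 * Real.sqrt 3 / (40 * Real.pi) - 3 := by
  have hinj : Function.Injective fun m : ℕ => 3 * m + 1 := fun a b h => by
    simpa using h
  have hsupp : Function.support (fun n : ℕ => (1 / 3 : ℝ) ^ n *
      firstHitCount (1, 1) (· = (0, 2)) n) ⊆ Set.range fun m : ℕ => 3 * m + 1 := by
    intro n hn
    by_contra hr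
    refine hn ?_
    have hz := firstHitCount_eq_zero n 1 1 fun hd => hr ⟨n / 3, by dsimp only; omega⟩
    simp only [hz, Nat.cast_zero, mul_zero]
  have htail := (summable_gaussTerm le_rfl).tsum_eq_zero_add
  rw [tsum_gaussTerm_two_eq] at htail
  rw [hitProb, ← hinj.tsum_eq hsupp]
  simp only [firstHitCount_one_one, hitTerm_eq_gaussTerm]
  rw [tsum_mul_left, eq_sub_of_add_eq' htail.symm, gaussTerm]
  ring
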